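/- Let H be a twisted form of J(W) × J(W) over F such that the even part H₀ is a quadratic separable field extension K of F. Then H is isomorphic, as an F-superalgebra, to J(W) ⊗_F K (with even part F1 ⊗ K and odd part W ⊗ K). -/

import Mathlib

open scoped TensorProduct
noncomputable section
namespace Kac

/-! ### Superalgebra isomorphisms and automorphisms -/

@[ext]
structure SuperIso (S A B : Type) [CommRing S]
    [AddCommGroup A] [Module S A] [Mul A]
    [AddCommGroup B] [Module S B] [Mul B]
    (evA odA : Submodule S A) (evB odB : Submodule S B) : Type where
  e : A ≃ₗ[S] B
  map_mul' : ∀ x y : A, e (x * y) = e x * e y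
  map_even : evA.map e.toLinearMap = evB
  map_odd : odA.map e.toLinearMap = odB

abbrev SuperAut (S A : Type) [CommRing S] [AddCommGroup A] [Module S A] [Mul A]
    (ev od : Submodule S A) := SuperIso S A A ev od ev od

namespace SuperAut

variable {S A : Type} [CommRing S] [AddCommGroup A] [Module S A] [Mul A]
variable {ev od : Submodule S A}

private lemma map_symm {f : A ≃ₗ[S] A} {p : Submodule S A}
    (h : p.map f.toLinearMap = p) : p.map f.symm.toLinearMap = p := by
  have h2 : f.symm.toLinearMap.comp f.toLinearMap = LinearMap.id := by
    ext x; simp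
  calc p.map f.symm.toLinearMap
      = (p.map f.toLinearMap).map f.symm.toLinearMap := by rw [h]
    _ = p.map (f.symm.toLinearMap.comp f.toLinearMap) := by
        rw [Submodule.map_comp]
    _ = p := by rw [h2, Submodule.map_id]

instance : Group (SuperAut S A ev od) where
  one := ⟨LinearEquiv.refl S A, fun _ _ => rfl, Submodule.map_id _, Submodule.map_id _⟩
  mul f g := ⟨g.e.trans f.e,
    fun x y => by simp [LinearEquiv.trans_apply, g.map_mul', f.map_mul'],
    by rw [LinearEquiv.coe_trans, Submodule.map_comp, g.map_even, f.map_even],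
    by rw [LinearEquiv.coe_trans, Submodule.map_comp, g.map_odd, f.map_odd]⟩
  inv f := ⟨f.e.symm,
    fun x y => f.e.injective <| by simp [f.map_mul'],
    map_symm f.map_even, map_symm f.map_odd⟩
  mul_assoc f g h := by apply SuperIso.ext; apply LinearEquiv.ext; intro x; rfl
  one_mul f := by apply SuperIso.ext; apply LinearEquiv.ext; intro x; rfl
  mul_one f := by apply SuperIso.ext; apply LinearEquiv.ext; intro x; rfl
  inv_mul_cancel f := by
    apply SuperIso.ext; apply LinearEquiv.ext; intro x
    exact f.e.symm_apply_apply x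

end SuperAut

/-- The predicate that a pair of submodules `ev`, `od` makes a non-unital
(possibly non-associative) algebra `B` into a superalgebra. -/
def IsSuperalgebra (S B : Type) [CommRing S] [NonUnitalNonAssocRing B] [Module S B]
    (ev od : Submodule S B) : Prop :=
  ev ⊔ od = ⊤ ∧ ev ⊓ od = ⊥ ∧
  (∀ x ∈ ev, ∀ y ∈ ev, x * y ∈ ev) ∧ (∀ x ∈ ev, ∀ y ∈ od, x * y ∈ od) ∧
  (∀ x ∈ od, ∀ y ∈ ev, x * y ∈ od) ∧ (∀ x ∈ od, ∀ y ∈ od, x * y ∈ ev)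

/-! ### Submodules given by vanishing of coordinates -/

def stdSub (S R : Type) [Semiring S] [AddCommGroup R] [Module S R] (n : ℕ)
    (s : Set (Fin n)) : Submodule S (Fin n → R) where
  carrier := {x | ∀ i, i ∉ s → x i = 0}
  add_mem' := fun {a b} ha hb i hi => by
    simp [Pi.add_apply, ha i hi, hb i hi]
  zero_mem' := fun i _ => rfl
  smul_mem' := fun c x hx i hi => by
    simp [Pi.smul_apply, hx i hi]

/-! ### Gradings by abelian groups -/

section Gradings

variable {G H S A : Type} [CommGroup G] [CommGroup H] [CommRing S]
  [AddCommGroup A] [Module S A] [Mul A]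

/-- `comp` is a `G`-grading of the superalgebra `(A, ev, od)`. -/
def IsSuperGrading (ev od : Submodule S A) (comp : G → Submodule S A) : Prop :=
  (letI := Classical.decEq G; DirectSum.IsInternal comp) ∧
  (∀ (g h : G) (x y : A), x ∈ comp g → y ∈ comp h → x * y ∈ comp (g * h)) ∧
  (∀ g, comp g = (comp g ⊓ ev) ⊔ (comp g ⊓ od))

/-- The grading with homogeneous elements `w i` of degrees `d i`. -/
def gradingOf (S : Type) {A G : Type} [CommRing S] [AddCommGroup A] [Module S A]
    [CommGroup G] {n : ℕ} (w : Fin n → A) (d : Fin n → G) : G → Submodule S A :=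
  fun g => Submodule.span S (w '' {i | d i = g})

/-- Isomorphism of two `G`-gradings on a superalgebra. -/
def GradIso (ev od : Submodule S A) (comp comp' : G → Submodule S A) : Prop :=
  ∃ φ : SuperAut S A ev od, ∀ g, (comp g).map φ.e.toLinearMap = comp' g

/-- `Δ` refines `Γ`. -/
def Refines (Δ : H → Submodule S A) (Γ : G → Submodule S A) : Prop :=
  ∀ h, Δ h ≠ ⊥ → ∃ g, Δ h ≤ Γ g

/-- Equivalence of a `G`-grading and an `H`-grading on a superalgebra. -/
def GradEquiv (ev od : Submodule S A) (Γ : G → Submodule S A)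
    (Δ : H → Submodule S A) : Prop :=
  ∃ φ : SuperAut S A ev od, ∃ α : {g : G // Γ g ≠ ⊥} → {h : H // Δ h ≠ ⊥},
    Function.Bijective α ∧
    ∀ g : {g : G // Γ g ≠ ⊥}, (Γ g.1).map φ.e.toLinearMap = Δ (α g).1

/-- A grading is fine if any grading refining it has the same nonzero
homogeneous components. -/
def IsFine (ev od : Submodule S A) (Γ : G → Submodule S A) : Prop :=
  ∀ (H : Type) (_ : CommGroup H) (Δ : H → Submodule S A),
    IsSuperGrading ev od Δ → Refines Δ Γ →
      {p : Submodule S A | p ≠ ⊥ ∧ ∃ h, Δ h = p} =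
      {p : Submodule S A | p ≠ ⊥ ∧ ∃ g, Γ g = p}

end Gradings

/-! ### SL₂ and the semidirect product with C₂ -/

abbrev SL2 (R : Type) [CommRing R] := Matrix.SpecialLinearGroup (Fin 2) R

def swapAut (M : Type) [Monoid M] : MulAut (M × M) := MulEquiv.prodComm

lemma swapAut_sq (M : Type) [Monoid M] : swapAut M * swapAut M = 1 :=
  MulEquiv.ext fun _ => rfl

/-- The action of `C₂ = Multiplicative (ZMod 2)` on `M × M` by swapping the factors. -/
def swapHom (M : Type) [Group M] : Multiplicative (ZMod 2) →* MulAut (M × M) :=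
  MonoidHom.mk' (fun c => if c.toAdd = 0 then 1 else swapAut M) (by
    intro a b
    have key : ∀ c : Multiplicative (ZMod 2),
        c = Multiplicative.ofAdd 0 ∨ c = Multiplicative.ofAdd 1 := by decide
    rcases key a with rfl | rfl <;> rcases key b with rfl | rfl <;>
      simp [← ofAdd_add, swapAut_sq] <;> exact fun h => absurd (by decide) h)

end Kac
/-! ### The (base-changed) Kaplansky superalgebra `K₃ ⊗ R` -/

namespace Kac

section Algebras

variable (F : Type) [Field F] (R : Type) [CommRing R] [Algebra F R]

/-- Coordinates: `0 ↦ a`, `1 ↦ u`, `2 ↦ v`. -/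
def K3A (F : Type) [Field F] (R : Type) [CommRing R] [Algebra F R] : Type := Fin 3 → R

instance : AddCommGroup (K3A F R) := Pi.addCommGroup
instance (S : Type) [Semiring S] [Module S R] : Module S (K3A F R) := Pi.module _ _ _

namespace K3A
variable {F R}

def mulFun (x y : K3A F R) : K3A F R := fun i =>
  match i with
  | ⟨0, _⟩ => x 0 * y 0 + (x 1 * y 2 - x 2 * y 1)
  | ⟨1, _⟩ => algebraMap F R 2⁻¹ * (x 0 * y 1 + y 0 * x 1)
  | ⟨2, _⟩ => algebraMap F R 2⁻¹ * (x 0 * y 2 + y 0 * x 2)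

instance : Mul (K3A F R) := ⟨mulFun⟩

lemma mul_def (x y : K3A F R) : x * y = mulFun x y := rfl

@[simp] lemma add_apply (x y : K3A F R) (i : Fin 3) : (x + y) i = x i + y i := rfl
@[simp] lemma sub_apply (x y : K3A F R) (i : Fin 3) : (x - y) i = x i - y i := rfl
@[simp] lemma neg_apply (x : K3A F R) (i : Fin 3) : (-x) i = -(x i) := rfl
@[simp] lemma zero_apply (i : Fin 3) : (0 : K3A F R) i = 0 := rfl
@[simp] lemma smul_apply (S : Type) [Semiring S] [Module S R] (c : S) (x : K3A F R) (i : Fin 3) :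
    (c • x) i = c • (x i) := rfl

variable (F R)

/-- The even part `R·a`. -/
def even (S : Type) [Semiring S] [Module S R] : Submodule S (K3A F R) := stdSub S R 3 {0}
/-- The odd part `W ⊗ R`. -/
def odd (S : Type) [Semiring S] [Module S R] : Submodule S (K3A F R) := stdSub S R 3 {1, 2}

/-- The element `a`. -/
def aE : K3A F R := ![1, 0, 0]
/-- The element of `W ⊗ R` with coordinates `w` in the symplectic basis `{u, v}`. -/
def wE (w : Fin 2 → R) : K3A F R := ![0, w 0, w 1]

end K3A

/-- `J(W) ⊗ R`; coordinates: `0 ↦ 1`, `1 ↦ u`, `2 ↦ v`. -/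
def JW1A (R : Type) [CommRing R] : Type := Fin 3 → R

instance : AddCommGroup (JW1A R) := Pi.addCommGroup
instance (S : Type) [Semiring S] [Module S R] : Module S (JW1A R) := Pi.module _ _ _

namespace JW1A
variable {R}

def mulFun (x y : JW1A R) : JW1A R := fun i =>
  match i with
  | ⟨0, _⟩ => x 0 * y 0 + (x 1 * y 2 - x 2 * y 1)
  | ⟨1, _⟩ => x 0 * y 1 + y 0 * x 1
  | ⟨2, _⟩ => x 0 * y 2 + y 0 * x 2

instance : Mul (JW1A R) := ⟨mulFun⟩

lemma mul_def (x y : JW1A R) : x * y = mulFun x y := rfl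

@[simp] lemma add_apply (x y : JW1A R) (i : Fin 3) : (x + y) i = x i + y i := rfl
@[simp] lemma sub_apply (x y : JW1A R) (i : Fin 3) : (x - y) i = x i - y i := rfl
@[simp] lemma neg_apply (x : JW1A R) (i : Fin 3) : (-x) i = -(x i) := rfl
@[simp] lemma zero_apply (i : Fin 3) : (0 : JW1A R) i = 0 := rfl
@[simp] lemma smul_apply (S : Type) [Semiring S] [Module S R] (c : S) (x : JW1A R) (i : Fin 3) :
    (c • x) i = c • (x i) := rfl

variable (R)

def even (S : Type) [Semiring S] [Module S R] : Submodule S (JW1A R) := stdSub S R 3 {0}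
def odd (S : Type) [Semiring S] [Module S R] : Submodule S (JW1A R) := stdSub S R 3 {1, 2}

def oneE : JW1A R := ![1, 0, 0]
def wE (w : Fin 2 → R) : JW1A R := ![0, w 0, w 1]

end JW1A

/-- `(K₃ × K₃) ⊗ R`; coordinates `0,1,2` for the first copy (`a,u,v`),
`3,4,5` for the second copy. -/
def K33A (F : Type) [Field F] (R : Type) [CommRing R] [Algebra F R] : Type := Fin 6 → R

instance : AddCommGroup (K33A F R) := Pi.addCommGroup
instance (S : Type) [Semiring S] [Module S R] : Module S (K33A F R) := Pi.module _ _ _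

namespace K33A
variable {F R}

def mulFun (x y : K33A F R) : K33A F R := fun i =>
  match i with
  | ⟨0, _⟩ => x 0 * y 0 + (x 1 * y 2 - x 2 * y 1)
  | ⟨1, _⟩ => algebraMap F R 2⁻¹ * (x 0 * y 1 + y 0 * x 1)
  | ⟨2, _⟩ => algebraMap F R 2⁻¹ * (x 0 * y 2 + y 0 * x 2)
  | ⟨3, _⟩ => x 3 * y 3 + (x 4 * y 5 - x 5 * y 4)
  | ⟨4, _⟩ => algebraMap F R 2⁻¹ * (x 3 * y 4 + y 3 * x 4)
  | ⟨5, _⟩ => algebraMap F R 2⁻¹ * (x 3 * y 5 + y 3 * x 5)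

instance : Mul (K33A F R) := ⟨mulFun⟩

lemma mul_def (x y : K33A F R) : x * y = mulFun x y := rfl

@[simp] lemma add_apply (x y : K33A F R) (i : Fin 6) : (x + y) i = x i + y i := rfl
@[simp] lemma sub_apply (x y : K33A F R) (i : Fin 6) : (x - y) i = x i - y i := rfl
@[simp] lemma neg_apply (x : K33A F R) (i : Fin 6) : (-x) i = -(x i) := rfl
@[simp] lemma zero_apply (i : Fin 6) : (0 : K33A F R) i = 0 := rfl
@[simp] lemma smul_apply (S : Type) [Semiring S] [Module S R] (c : S) (x : K33A F R) (i : Fin 6) :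
    (c • x) i = c • (x i) := rfl

variable (F R)

def even (S : Type) [Semiring S] [Module S R] : Submodule S (K33A F R) := stdSub S R 6 {0, 3}
def odd (S : Type) [Semiring S] [Module S R] : Submodule S (K33A F R) := stdSub S R 6 {1, 2, 4, 5}

/-- The element `(a, 0)`. -/
def aLeft : K33A F R := ![1, 0, 0, 0, 0, 0]
/-- The element `(0, a)`. -/
def aRight : K33A F R := ![0, 0, 0, 1, 0, 0]
/-- The element `(v, w)` of the odd part, `v, w ∈ W ⊗ R`. -/
def oddE (w w' : Fin 2 → R) : K33A F R := ![0, w 0, w 1, 0, w' 0, w' 1]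
/-- The exchange automorphism `(x, y) ↦ (y, x)`. -/
def swapFun (x : K33A F R) : K33A F R := fun i =>
  match i with
  | ⟨0, _⟩ => x 3
  | ⟨1, _⟩ => x 4
  | ⟨2, _⟩ => x 5
  | ⟨3, _⟩ => x 0
  | ⟨4, _⟩ => x 1
  | ⟨5, _⟩ => x 2

end K33A

/-- `(J(W) × J(W)) ⊗ R`. -/
def JW2A (R : Type) [CommRing R] : Type := Fin 6 → R

instance : AddCommGroup (JW2A R) := Pi.addCommGroup
instance (S : Type) [Semiring S] [Module S R] : Module S (JW2A R) := Pi.module _ _ _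

namespace JW2A
variable {R}

def mulFun (x y : JW2A R) : JW2A R := fun i =>
  match i with
  | ⟨0, _⟩ => x 0 * y 0 + (x 1 * y 2 - x 2 * y 1)
  | ⟨1, _⟩ => x 0 * y 1 + y 0 * x 1
  | ⟨2, _⟩ => x 0 * y 2 + y 0 * x 2
  | ⟨3, _⟩ => x 3 * y 3 + (x 4 * y 5 - x 5 * y 4)
  | ⟨4, _⟩ => x 3 * y 4 + y 3 * x 4
  | ⟨5, _⟩ => x 3 * y 5 + y 3 * x 5

instance : Mul (JW2A R) := ⟨mulFun⟩

lemma mul_def (x y : JW2A R) : x * y = mulFun x y := rfl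

@[simp] lemma add_apply (x y : JW2A R) (i : Fin 6) : (x + y) i = x i + y i := rfl
@[simp] lemma sub_apply (x y : JW2A R) (i : Fin 6) : (x - y) i = x i - y i := rfl
@[simp] lemma neg_apply (x : JW2A R) (i : Fin 6) : (-x) i = -(x i) := rfl
@[simp] lemma zero_apply (i : Fin 6) : (0 : JW2A R) i = 0 := rfl
@[simp] lemma smul_apply (S : Type) [Semiring S] [Module S R] (c : S) (x : JW2A R) (i : Fin 6) :
    (c • x) i = c • (x i) := rfl

variable (R)

def even (S : Type) [Semiring S] [Module S R] : Submodule S (JW2A R) := stdSub S R 6 {0, 3}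
def odd (S : Type) [Semiring S] [Module S R] : Submodule S (JW2A R) := stdSub S R 6 {1, 2, 4, 5}

/-- The element `(1, 0)`. -/
def oneLeft : JW2A R := ![1, 0, 0, 0, 0, 0]
/-- The element `(0, 1)`. -/
def oneRight : JW2A R := ![0, 0, 0, 1, 0, 0]
def oddE (w w' : Fin 2 → R) : JW2A R := ![0, w 0, w 1, 0, w' 0, w' 1]
def swapFun (x : JW2A R) : JW2A R := fun i =>
  match i with
  | ⟨0, _⟩ => x 3
  | ⟨1, _⟩ => x 4
  | ⟨2, _⟩ => x 5
  | ⟨3, _⟩ => x 0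
  | ⟨4, _⟩ => x 1
  | ⟨5, _⟩ => x 2

end JW2A

/-- Kac's superalgebra `K₁₀ ⊗ R`.  CoordinatesL `0 ↦ 1`, `1 ↦ a⊗a`,
`2 ↦ u⊗u`, `3 ↦ u⊗v`, `4 ↦ v⊗u`, `5 ↦ v⊗v`, `6 ↦ u⊗a`, `7 ↦ v⊗a`,
`8 ↦ a⊗u`, `9 ↦ a⊗v`. -/
def K10A (F : Type) [Field F] (R : Type) [CommRing R] [Algebra F R] : Type := Fin 10 → R

instance : AddCommGroup (K10A F R) := Pi.addCommGroup
instance (S : Type) [Semiring S] [Module S R] : Module S (K10A F R) := Pi.module _ _ _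

namespace K10A
variable {F R}

def mulFun (x y : K10A F R) : K10A F R := fun i =>
  match i with
  | ⟨0, _⟩ => x 0 * y 0 - algebraMap F R (3/16) * (x 1 * y 1)
      + algebraMap F R (3/4) * (x 2 * y 5 + x 5 * y 2 - x 3 * y 4 - x 4 * y 3)
      - algebraMap F R (3/8) * (x 6 * y 7 - x 7 * y 6 + x 8 * y 9 - x 9 * y 8)
  | ⟨1, _⟩ => x 0 * y 1 + x 1 * y 0 + x 1 * y 1
      - (x 2 * y 5 + x 5 * y 2 - x 3 * y 4 - x 4 * y 3)
      + (x 6 * y 7 - x 7 * y 6) + (x 8 * y 9 - x 9 * y 8)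
  | ⟨2, _⟩ => x 0 * y 2 + x 2 * y 0 + algebraMap F R 4⁻¹ * (x 1 * y 2 + x 2 * y 1)
      + algebraMap F R 4⁻¹ * (x 6 * y 8 - x 8 * y 6)
  | ⟨3, _⟩ => x 0 * y 3 + x 3 * y 0 + algebraMap F R 4⁻¹ * (x 1 * y 3 + x 3 * y 1)
      + algebraMap F R 4⁻¹ * (x 6 * y 9 - x 9 * y 6)
  | ⟨4, _⟩ => x 0 * y 4 + x 4 * y 0 + algebraMap F R 4⁻¹ * (x 1 * y 4 + x 4 * y 1)
      + algebraMap F R 4⁻¹ * (x 7 * y 8 - x 8 * y 7)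
  | ⟨5, _⟩ => x 0 * y 5 + x 5 * y 0 + algebraMap F R 4⁻¹ * (x 1 * y 5 + x 5 * y 1)
      + algebraMap F R 4⁻¹ * (x 7 * y 9 - x 9 * y 7)
  | ⟨6, _⟩ => x 0 * y 6 + x 6 * y 0 + algebraMap F R 2⁻¹ * (x 1 * y 6 + x 6 * y 1)
      + algebraMap F R 2⁻¹ * (x 2 * y 9 + x 9 * y 2) - algebraMap F R 2⁻¹ * (x 3 * y 8 + x 8 * y 3)
  | ⟨7, _⟩ => x 0 * y 7 + x 7 * y 0 + algebraMap F R 2⁻¹ * (x 1 * y 7 + x 7 * y 1)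
      + algebraMap F R 2⁻¹ * (x 4 * y 9 + x 9 * y 4) - algebraMap F R 2⁻¹ * (x 5 * y 8 + x 8 * y 5)
  | ⟨8, _⟩ => x 0 * y 8 + x 8 * y 0 + algebraMap F R 2⁻¹ * (x 1 * y 8 + x 8 * y 1)
      - algebraMap F R 2⁻¹ * (x 2 * y 7 + x 7 * y 2) + algebraMap F R 2⁻¹ * (x 4 * y 6 + x 6 * y 4)
  | ⟨9, _⟩ => x 0 * y 9 + x 9 * y 0 + algebraMap F R 2⁻¹ * (x 1 * y 9 + x 9 * y 1)
      - algebraMap F R 2⁻¹ * (x 3 * y 7 + x 7 * y 3) + algebraMap F R 2⁻¹ * (x 5 * y 6 + x 6 * y 5)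

instance : Mul (K10A F R) := ⟨mulFun⟩

lemma mul_def (x y : K10A F R) : x * y = mulFun x y := rfl

@[simp] lemma add_apply (x y : K10A F R) (i : Fin 10) : (x + y) i = x i + y i := rfl
@[simp] lemma sub_apply (x y : K10A F R) (i : Fin 10) : (x - y) i = x i - y i := rfl
@[simp] lemma neg_apply (x : K10A F R) (i : Fin 10) : (-x) i = -(x i) := rfl
@[simp] lemma zero_apply (i : Fin 10) : (0 : K10A F R) i = 0 := rfl
@[simp] lemma smul_apply (S : Type) [Semiring S] [Module S R] (c : S) (x : K10A F R) (i : Fin 10) :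
    (c • x) i = c • (x i) := rfl

variable (F R)

def even (S : Type) [Semiring S] [Module S R] : Submodule S (K10A F R) :=
  stdSub S R 10 {0, 1, 2, 3, 4, 5}
def odd (S : Type) [Semiring S] [Module S R] : Submodule S (K10A F R) :=
  stdSub S R 10 {6, 7, 8, 9}

/-- The unity `1`. -/
def oneE : K10A F R := ![1, 0, 0, 0, 0, 0, 0, 0, 0, 0]
/-- The element `a ⊗ a`. -/
def aaE : K10A F R := ![0, 1, 0, 0, 0, 0, 0, 0, 0, 0]
/-- The element `v ⊗ w ∈ W ⊗ W`. -/
def wwE (w w' : Fin 2 → R) : K10A F R :=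
  ![0, 0, w 0 * w' 0, w 0 * w' 1, w 1 * w' 0, w 1 * w' 1, 0, 0, 0, 0]
/-- The element `w ⊗ a`, `w ∈ W ⊗ R`. -/
def waE (w : Fin 2 → R) : K10A F R := ![0, 0, 0, 0, 0, 0, w 0, w 1, 0, 0]
/-- The element `a ⊗ w`, `w ∈ W ⊗ R`. -/
def awE (w : Fin 2 → R) : K10A F R := ![0, 0, 0, 0, 0, 0, 0, 0, w 0, w 1]
/-- The exchange automorphism `τ`, `τ(x ⊗ y) = (-1)^{|x||y|} y ⊗ x`. -/
def tauFun (x : K10A F R) : K10A F R := fun i =>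
  match i with
  | ⟨0, _⟩ => x 0
  | ⟨1, _⟩ => x 1
  | ⟨2, _⟩ => -x 2
  | ⟨3, _⟩ => -x 4
  | ⟨4, _⟩ => -x 3
  | ⟨5, _⟩ => -x 5
  | ⟨6, _⟩ => x 8
  | ⟨7, _⟩ => x 9
  | ⟨8, _⟩ => x 6
  | ⟨9, _⟩ => x 7

end K10A

end Algebras

end Kac

namespace Kac

/-- `p` (a submodule of `B`, e.g. the even part) is isomorphic, as an
`F`-algebra, to `C`: there is an `F`-linear bijection preserving products. -/
def SubAlgIso (F B C : Type) [Field F] [NonUnitalNonAssocRing B] [Module F B]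
    [Ring C] [Algebra F C] (p : Submodule F B) : Prop :=
  ∃ e : p ≃ₗ[F] C, ∀ (x y : p) (h : (x : B) * (y : B) ∈ p),
    e ⟨(x : B) * (y : B), h⟩ = e x * e y

/-- A quadratic étale `F`-algebra: two-dimensional, and either isomorphic to
`F × F` or a (quadratic) separable field extension of `F`. -/
def IsQuadraticEtale (F K : Type) [Field F] [CommRing K] [Algebra F K] : Prop :=
  Module.finrank F K = 2 ∧
    (Nonempty (K ≃ₐ[F] (F × F)) ∨ (IsField K ∧ Algebra.IsSeparable F K))

end Kac

namespace Kac

namespace JW2A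

variable {R : Type} [CommRing R]

lemma mul_apply_zero (x y : JW2A R) :
    (x * y) 0 = x 0 * y 0 + (x 1 * y 2 - x 2 * y 1) := rfl
lemma mul_apply_one (x y : JW2A R) : (x * y) 1 = x 0 * y 1 + y 0 * x 1 := rfl
lemma mul_apply_two (x y : JW2A R) : (x * y) 2 = x 0 * y 2 + y 0 * x 2 := rfl
lemma mul_apply_three (x y : JW2A R) :
    (x * y) 3 = x 3 * y 3 + (x 4 * y 5 - x 5 * y 4) := rfl
lemma mul_apply_four (x y : JW2A R) : (x * y) 4 = x 3 * y 4 + y 3 * x 4 := rfl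
lemma mul_apply_five (x y : JW2A R) : (x * y) 5 = x 3 * y 5 + y 3 * x 5 := rfl

lemma ext_iff' {x y : JW2A R} : x = y ↔
    x 0 = y 0 ∧ x 1 = y 1 ∧ x 2 = y 2 ∧ x 3 = y 3 ∧ x 4 = y 4 ∧ x 5 = y 5 := by
  refine ⟨by rintro rfl; simp, fun h => ?_⟩
  funext i
  fin_cases i <;> simp_all

lemma mem_even {S : Type} [Semiring S] [Module S R] {x : JW2A R} :
    x ∈ even R S ↔ x 1 = 0 ∧ x 2 = 0 ∧ x 4 = 0 ∧ x 5 = 0 := by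
  change (∀ i, i ∉ ({0, 3} : Set (Fin 6)) → x i = 0) ↔ _
  simp [Fin.forall_fin_succ]

lemma mem_odd {S : Type} [Semiring S] [Module S R] {x : JW2A R} :
    x ∈ odd R S ↔ x 0 = 0 ∧ x 3 = 0 := by
  change (∀ i, i ∉ ({1, 2, 4, 5} : Set (Fin 6)) → x i = 0) ↔ _
  simp [Fin.forall_fin_succ]

/-- The coordinate functionals of `JW2A R`. -/
def coord (i : Fin 6) : JW2A R →ₗ[R] R := LinearMap.proj i

@[simp] lemma coord_apply (i : Fin 6) (x : JW2A R) : coord i x = x i := rfl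

lemma finrank_eq (L : Type) [Field L] : Module.finrank L (JW2A L) = 6 := by
  change Module.finrank L (Fin 6 → L) = 6
  simp

end JW2A

namespace JW1A

variable {R : Type} [CommRing R]

lemma mul_apply_zero (x y : JW1A R) :
    (x * y) 0 = x 0 * y 0 + (x 1 * y 2 - x 2 * y 1) := rfl
lemma mul_apply_one (x y : JW1A R) : (x * y) 1 = x 0 * y 1 + y 0 * x 1 := rfl
lemma mul_apply_two (x y : JW1A R) : (x * y) 2 = x 0 * y 2 + y 0 * x 2 := rfl

lemma mem_even {S : Type} [Semiring S] [Module S R] {x : JW1A R} :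
    x ∈ even R S ↔ x 1 = 0 ∧ x 2 = 0 := by
  change (∀ i, i ∉ ({0} : Set (Fin 3)) → x i = 0) ↔ _
  simp [Fin.forall_fin_succ]

lemma mem_odd {S : Type} [Semiring S] [Module S R] {x : JW1A R} :
    x ∈ odd R S ↔ x 0 = 0 := by
  change (∀ i, i ∉ ({1, 2} : Set (Fin 3)) → x i = 0) ↔ _
  simp [Fin.forall_fin_succ]

end JW1A

/-- Inverting a superalgebra isomorphism. -/
def SuperIso.symm {S A B : Type} [CommRing S]
    [AddCommGroup A] [Module S A] [Mul A] [AddCommGroup B] [Module S B] [Mul B]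
    {evA odA : Submodule S A} {evB odB : Submodule S B}
    (f : SuperIso S A B evA odA evB odB) : SuperIso S B A evB odB evA odA where
  e := f.e.symm
  map_mul' x y := f.e.injective (by simp [f.map_mul'])
  map_even := (Submodule.map_symm_eq_iff f.e).2 f.map_even
  map_odd := (Submodule.map_symm_eq_iff f.e).2 f.map_odd

/-- A linear bijection respecting the parities in one direction respects them. -/
lemma map_eq_of_isCompl {S A B : Type} [CommRing S]
    [AddCommGroup A] [Module S A] [AddCommGroup B] [Module S B]
    {p q : Submodule S A} {p' q' : Submodule S B} (e : A ≃ₗ[S] B)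
    (hpq : p ⊔ q = ⊤) (hpq' : p' ⊓ q' = ⊥)
    (hp : ∀ x ∈ p, e x ∈ p') (hq : ∀ x ∈ q, e x ∈ q') :
    p.map e.toLinearMap = p' := by
  refine le_antisymm (Submodule.map_le_iff_le_comap.2 hp) fun y hy => ?_
  obtain ⟨a, ha, b, hb, hab⟩ := Submodule.mem_sup.1 (hpq ▸ Submodule.mem_top : e.symm y ∈ p ⊔ q)
  have hy' : y = e a + e b := by rw [← map_add, hab, e.apply_symm_apply]
  have hb0 : e b ∈ p' ⊓ q' :=
    ⟨by rw [← sub_eq_iff_eq_add'.2 hy']; exact p'.sub_mem hy (hp a ha), hq b hb⟩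
  rw [hpq', Submodule.mem_bot] at hb0
  exact ⟨a, ha, by simp [hy', hb0]⟩

/-- A functional vanishing on `1 ⊗ p` vanishes on the image of the base change of `p`. -/
lemma functional_eq_zero_of_map_baseChange {F L H B : Type} [Field F] [Field L] [Algebra F L]
    [AddCommGroup H] [Module F H] [AddCommGroup B] [Module L B]
    (e : (L ⊗[F] H) ≃ₗ[L] B) {p : Submodule F H} {q : Submodule L B}
    (hpq : (p.baseChange L).map e.toLinearMap = q) (f : B →ₗ[L] L)
    (hf : ∀ x ∈ p, f (e (1 ⊗ₜ x)) = 0) {z : B} (hz : z ∈ q) : f z = 0 := by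
  have hle : q ≤ LinearMap.ker f := by
    rw [← hpq, Submodule.map_le_iff_le_comap, Submodule.baseChange_eq_span, Submodule.span_le]
    rintro _ ⟨x, hx, rfl⟩
    exact hf x hx
  exact hle hz

/-- A nonzero map between fields respecting sums and products is a ring homomorphism. -/
lemma exists_ringHom_of_add_of_mul {K L : Type} [Field K] [Field L] (f : K → L)
    (hadd : ∀ a b, f (a + b) = f a + f b) (hmul : ∀ a b, f (a * b) = f a * f b)
    (hne : ∃ a, f a ≠ 0) : ∃ φ : K →+* L, ∀ a, f a = φ a := by
  obtain ⟨a, ha⟩ := hne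
  have h1 : f 1 = 1 := by
    have := hmul 1 a
    rw [one_mul] at this
    exact mul_right_cancel₀ ha (by rw [one_mul, ← this])
  exact ⟨RingHom.mk' ⟨⟨f, h1⟩, hmul⟩ hadd, fun _ => rfl⟩

/-- A six-dimensional superalgebra which embeds in `J(W) × J(W)` over another field `L`, whose even
part contains a copy of a quadratic extension `K` and which has odd elements `u`, `v` with `uv` the
unity of `K`, is isomorphic to `J(W) ⊗ K`. -/
lemma nonempty_superIso_JW1A {F L H K : Type} [Field F] [Field L]
    [NonUnitalNonAssocRing H] [Module F H] [IsScalarTower F H H]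
    [FiniteDimensional F H] [Field K] [Algebra F K]
    (hquad : Module.finrank F K = 2) (hH : Module.finrank F H = 6)
    {evH odH : Submodule F H} (hsuper : IsSuperalgebra F H evH odH)
    (ι : H →+ JW2A L) (hι : Function.Injective ι) (hmul : ∀ x y, ι (x * y) = ι x * ι y)
    (hod : ∀ x ∈ odH, ι x ∈ JW2A.odd L L)
    (κ : K →ₗ[F] H) (hκev : ∀ a, κ a ∈ evH)
    (φ ψ : K →+* L) (hκ : ∀ a, ι (κ a) = ![φ a, 0, 0, ψ a, 0, 0])
    {u v : H} (hu : u ∈ odH) (hv : v ∈ odH) (huv : u * v = κ 1) :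
    Nonempty (SuperIso F H (JW1A K) evH odH (JW1A.even K F) (JW1A.odd K F)) := by
  obtain ⟨-, hinf, -, hevod, -, -⟩ := hsuper
  let g : JW1A K →ₗ[F] H :=
    { toFun := fun x => κ (x 0) + κ (x 1) * u + κ (x 2) * v
      map_add' := fun x y => by simp only [JW1A.add_apply, map_add, add_mul]; abel
      map_smul' := fun c x => by
        simp [JW1A.smul_apply, map_smul, smul_add, smul_mul_assoc] }
  have hg (x) : g x = κ (x 0) + κ (x 1) * u + κ (x 2) * v := rfl
  have hκ0 (a) : ι (κ a) 0 = φ a := by rw [hκ]; rfl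
  have hκ1 (a) : ι (κ a) 1 = 0 := by rw [hκ]; rfl
  have hκ2 (a) : ι (κ a) 2 = 0 := by rw [hκ]; rfl
  have hκ3 (a) : ι (κ a) 3 = ψ a := by rw [hκ]; rfl
  have hκ4 (a) : ι (κ a) 4 = 0 := by rw [hκ]; rfl
  have hκ5 (a) : ι (κ a) 5 = 0 := by rw [hκ]; rfl
  obtain ⟨hu0, hu3⟩ := JW2A.mem_odd.1 (hod u hu)
  obtain ⟨hv0, hv3⟩ := JW2A.mem_odd.1 (hod v hv)
  have h0 : ι u 1 * ι v 2 - ι u 2 * ι v 1 = 1 := by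
    have := congrArg (fun z => z 0) ((hmul u v).symm.trans (congrArg ι huv))
    simpa [JW2A.mul_apply_zero, hu0, hv0, hκ0] using this
  have h3 : ι u 4 * ι v 5 - ι u 5 * ι v 4 = 1 := by
    have := congrArg (fun z => z 3) ((hmul u v).symm.trans (congrArg ι huv))
    simpa [JW2A.mul_apply_three, hu3, hv3, hκ3] using this
  have hg0 (x) : ι (g x) 0 = φ (x 0) := by
    simp [hg, hmul, JW2A.mul_apply_zero, hκ0, hκ1, hκ2, hu0, hv0]
  have hg1 (x) : ι (g x) 1 = φ (x 1) * ι u 1 + φ (x 2) * ι v 1 := by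
    simp [hg, hmul, JW2A.mul_apply_one, hκ0, hκ1, hu0, hv0]
  have hg2 (x) : ι (g x) 2 = φ (x 1) * ι u 2 + φ (x 2) * ι v 2 := by
    simp [hg, hmul, JW2A.mul_apply_two, hκ0, hκ2, hu0, hv0]
  have hg3 (x) : ι (g x) 3 = ψ (x 0) := by
    simp [hg, hmul, JW2A.mul_apply_three, hκ3, hκ4, hκ5, hu3, hv3]
  have hg4 (x) : ι (g x) 4 = ψ (x 1) * ι u 4 + ψ (x 2) * ι v 4 := by
    simp [hg, hmul, JW2A.mul_apply_four, hκ3, hκ4, hu3, hv3]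
  have hg5 (x) : ι (g x) 5 = ψ (x 1) * ι u 5 + ψ (x 2) * ι v 5 := by
    simp [hg, hmul, JW2A.mul_apply_five, hκ3, hκ5, hu3, hv3]
  have hginj : Function.Injective g := by
    refine (injective_iff_map_eq_zero g).2 fun x hx => ?_
    have e0 := hg0 x
    have e1 := hg1 x
    have e2 := hg2 x
    simp only [hx, map_zero, JW2A.zero_apply] at e0 e1 e2
    have x1 : φ (x 1) = 0 := by
      linear_combination (-φ (x 1)) * h0 - ι v 2 * e1 + ι v 1 * e2
    have x2 : φ (x 2) = 0 := by
      linear_combination (-φ (x 2)) * h0 + ι u 2 * e1 - ι u 1 * e2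
    have x0 := (map_eq_zero φ).1 e0.symm
    rw [map_eq_zero] at x1 x2
    funext i
    fin_cases i
    exacts [x0, x1, x2]
  have hdim : Module.finrank F (JW1A K) = Module.finrank F H := by
    rw [hH]
    have : FiniteDimensional F K := Module.finite_of_finrank_eq_succ hquad
    change Module.finrank F (Fin 3 → K) = 6
    simp [Module.finrank_pi_fintype, hquad]
  have : FiniteDimensional F K := Module.finite_of_finrank_eq_succ hquad
  have : FiniteDimensional F (JW1A K) := inferInstanceAs (FiniteDimensional F (Fin 3 → K))
  let e : JW1A K ≃ₗ[F] H := LinearEquiv.ofInjectiveOfFinrankEq g hginj hdim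
  have he (x) : e x = g x := rfl
  have hev' : ∀ x ∈ JW1A.even K F, e x ∈ evH := fun x hx => by
    obtain ⟨x1, x2⟩ := JW1A.mem_even.1 hx
    simpa [he, hg, x1, x2] using hκev (x 0)
  have hod' : ∀ x ∈ JW1A.odd K F, e x ∈ odH := fun x hx => by
    rw [he, hg, JW1A.mem_odd.1 hx, map_zero, zero_add]
    exact odH.add_mem (hevod _ (hκev _) _ hu) (hevod _ (hκev _) _ hv)
  have hsup : JW1A.even K F ⊔ JW1A.odd K F = ⊤ := by
    refine eq_top_iff.2 fun x _ => Submodule.mem_sup.2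
      ⟨(![x 0, 0, 0] : Fin 3 → K), JW1A.mem_even.2 ⟨rfl, rfl⟩,
        (![0, x 1, x 2] : Fin 3 → K), JW1A.mem_odd.2 rfl, ?_⟩
    funext i
    fin_cases i
    exacts [add_zero _, zero_add _, zero_add _]
  refine ⟨SuperIso.symm ⟨e, fun x y => hι (JW2A.ext_iff'.2 ?_),
    map_eq_of_isCompl e hsup hinf hev' hod',
    map_eq_of_isCompl e ((sup_comm _ _).trans hsup) ((inf_comm _ _).trans hinf) hod' hev'⟩⟩
  simp only [he, hmul, JW2A.mul_apply_zero, JW2A.mul_apply_one, JW2A.mul_apply_two,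
    JW2A.mul_apply_three, JW2A.mul_apply_four, JW2A.mul_apply_five, hg0, hg1, hg2, hg3, hg4, hg5,
    JW1A.mul_apply_zero, JW1A.mul_apply_one, JW1A.mul_apply_two, map_add, map_sub, map_mul]
  refine ⟨?_, by ring, by ring, ?_, by ring, by ring⟩
  · linear_combination (-(φ (x 1) * φ (y 2) - φ (x 2) * φ (y 1))) * h0
  · linear_combination (-(ψ (x 1) * ψ (y 2) - ψ (x 2) * ψ (y 1))) * h3

end Kac

/-! ### STATEMENT 6 -/

open Kac in
/-- Let `H` be a twisted form of `J(W) × J(W)` over `F` whose even part is a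
quadratic separable field extension `K` of `F`.  Then `H ≅ J(W) ⊗_F K` as
`F`-superalgebras.  Here `J(W) ⊗_F K` is realized as `JW1A K`, with even part
`F1 ⊗ K` and odd part `W ⊗ K`. -/
theorem twisted_form_JW2_with_field_even_part
    (F : Type) [Field F] (hchar : (2 : F) ≠ 0)
    (H : Type) [NonUnitalNonAssocRing H] [Module F H]
    [SMulCommClass F H H] [IsScalarTower F H H] [FiniteDimensional F H]
    (evH odH : Submodule F H) (hsuper : IsSuperalgebra F H evH odH)
    (htwist : Nonempty (SuperIso (AlgebraicClosure F)
      ((AlgebraicClosure F) ⊗[F] H) (JW2A (AlgebraicClosure F))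
      (evH.baseChange (AlgebraicClosure F)) (odH.baseChange (AlgebraicClosure F))
      (JW2A.even (AlgebraicClosure F) (AlgebraicClosure F))
      (JW2A.odd (AlgebraicClosure F) (AlgebraicClosure F))))
    (K : Type) [Field K] [Algebra F K]
    (hquad : Module.finrank F K = 2) [Algebra.IsSeparable F K]
    (heven : SubAlgIso F H K evH) :
    Nonempty (SuperIso F H (JW1A K) evH odH (JW1A.even K F) (JW1A.odd K F)) := by
  obtain ⟨Φ⟩ := htwist
  let L := AlgebraicClosure F
  let ι : H →+ JW2A L :=
    Φ.e.toLinearMap.toAddMonoidHom.comp (TensorProduct.mk F L H 1).toAddMonoidHom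
  have hιdef (x) : ι x = Φ.e (1 ⊗ₜ x) := rfl
  have hι : Function.Injective ι :=
    Φ.e.injective.comp (Module.Flat.tensorProduct_mk_injective (R := F) (S := L) H)
  have hmul (x y) : ι (x * y) = ι x * ι y := by
    simp only [hιdef, ← Φ.map_mul', Algebra.TensorProduct.tmul_mul_tmul, mul_one]
  have hev : ∀ x ∈ evH, ι x ∈ JW2A.even L L := fun x hx =>
    Φ.map_even ▸ Submodule.mem_map_of_mem (Submodule.tmul_mem_baseChange_of_mem 1 hx)
  have hod : ∀ x ∈ odH, ι x ∈ JW2A.odd L L := fun x hx =>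
    Φ.map_odd ▸ Submodule.mem_map_of_mem (Submodule.tmul_mem_baseChange_of_mem 1 hx)
  have hH : Module.finrank F H = 6 := by
    rw [← Module.finrank_baseChange (R := L), Φ.e.finrank_eq, JW2A.finrank_eq]
  obtain ⟨k, hk⟩ := heven
  have hevmul := hsuper.2.2.1
  have hododev := hsuper.2.2.2.2.2
  let κ : K →ₗ[F] H := evH.subtype.comp k.symm.toLinearMap
  have hκev (a) : κ a ∈ evH := (k.symm a).2
  have hκsurj : ∀ x ∈ evH, ∃ a, κ a = x := fun x hx => ⟨k ⟨x, hx⟩, by simp [κ]⟩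
  have hκmul (a b) : κ (a * b) = κ a * κ b := by
    have h := hk (k.symm a) (k.symm b) (hevmul _ (hκev a) _ (hκev b))
    rw [k.apply_symm_apply, k.apply_symm_apply, ← LinearEquiv.eq_symm_apply] at h
    exact (congrArg Subtype.val h).symm
  have hκcoord (a) := JW2A.mem_even.1 (hev _ (hκev a))
  have hne (i : Fin 6) (z : JW2A L) (hz : z ∈ JW2A.even L L) (hzi : z i ≠ 0) :
      ∃ a, ι (κ a) i ≠ 0 := by
    by_contra! h
    refine hzi (functional_eq_zero_of_map_baseChange Φ.e Φ.map_even (JW2A.coord i)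
      (fun x hx => ?_) hz)
    obtain ⟨a, rfl⟩ := hκsurj x hx
    exact h a
  obtain ⟨φ, hφ⟩ := exists_ringHom_of_add_of_mul (fun a => ι (κ a) 0) (by simp)
    (fun a b => by simp [hκmul, hmul, JW2A.mul_apply_zero, hκcoord])
    (hne 0 (JW2A.oneLeft L) (JW2A.mem_even.2 ⟨rfl, rfl, rfl, rfl⟩) one_ne_zero)
  obtain ⟨ψ, hψ⟩ := exists_ringHom_of_add_of_mul (fun a => ι (κ a) 3) (by simp)
    (fun a b => by simp [hκmul, hmul, JW2A.mul_apply_three, hκcoord])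
    (hne 3 (JW2A.oneRight L) (JW2A.mem_even.2 ⟨rfl, rfl, rfl, rfl⟩) one_ne_zero)
  have hκ (a) : ι (κ a) = ![φ a, 0, 0, ψ a, 0, 0] := by
    obtain ⟨h1, h2, h4, h5⟩ := hκcoord a
    exact JW2A.ext_iff'.2 ⟨hφ a, h1, h2, hψ a, h4, h5⟩
  have hnondeg : ∃ u ∈ odH, ∃ v ∈ odH, u * v ≠ 0 := by
    by_contra! h
    have hdet : ∀ u ∈ odH, ∀ v ∈ odH, ι u 1 * ι v 2 - ι u 2 * ι v 1 = 0 := fun u hu v hv => by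
      have := congrArg (fun z => z 0) ((hmul u v).symm.trans (congrArg ι (h u hu v hv)))
      simpa [JW2A.mul_apply_zero, (JW2A.mem_odd.1 (hod u hu)).1] using this
    have hv2 : ∀ v ∈ odH, ι v 2 = 0 := fun v hv => by
      have : ι v 2 * 1 - ι v 1 * 0 = 0 := functional_eq_zero_of_map_baseChange Φ.e Φ.map_odd
        (ι v 2 • JW2A.coord 1 - ι v 1 • JW2A.coord 2)
        (fun u hu => by
          have := hdet u hu v hv
          simp only [LinearMap.sub_apply, LinearMap.smul_apply, JW2A.coord_apply, smul_eq_mul,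
            ← hιdef]
          linear_combination this)
        (z := JW2A.oddE L ![1, 0] 0) (JW2A.mem_odd.2 ⟨rfl, rfl⟩)
      simpa using this
    have := functional_eq_zero_of_map_baseChange Φ.e Φ.map_odd (JW2A.coord 2) hv2
        (z := JW2A.oddE L ![0, 1] 0) (JW2A.mem_odd.2 ⟨rfl, rfl⟩)
    exact one_ne_zero (α := L) this
  obtain ⟨u, hu, v, hv, huv⟩ := hnondeg
  obtain ⟨c, hc⟩ := hκsurj _ (hododev u hu v hv)
  have hc0 : c ≠ 0 := by
    rintro rfl
    exact huv (by rw [← hc, map_zero])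
  refine nonempty_superIso_JW1A hquad hH hsuper ι hι hmul hod κ hκev φ ψ hκ
    (hsuper.2.2.2.1 _ (hκev c⁻¹) _ hu) hv ?_
  rw [← inv_mul_cancel₀ hc0, hκmul, hc]
  obtain ⟨hu0, hu3⟩ := JW2A.mem_odd.1 (hod u hu)
  obtain ⟨hv0, hv3⟩ := JW2A.mem_odd.1 (hod v hv)
  refine hι (JW2A.ext_iff'.2 ?_)
  simp only [hmul, JW2A.mul_apply_zero, JW2A.mul_apply_one, JW2A.mul_apply_two,
    JW2A.mul_apply_three, JW2A.mul_apply_four, JW2A.mul_apply_five, hκcoord, hu0, hu3, hv0, hv3]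
  refine ⟨?_, ?_, ?_, ?_, ?_, ?_⟩ <;> ring
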